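/- Fix λ > 0, μ > 0, c₁, c₂ ∈ (0,1) with c₁ ≠ c₂, a = c₂/c₁, and α, γ with α+γ > 0. Define q₁(i,j) = (Γ(i+λ+1)/(Γ(λ+1)Γ(i+1)))(Γ(j+μ)/(Γ(μ)Γ(j+1)))(1/c₁)∫₁^∞ s^{-(2+1/c₁+λ)}(1−s^{-1})^i(1−s^{-a})^j s^{-aμ} ds and q₂(i,j) = (Γ(i+λ)/(Γ(λ)Γ(i+1)))(Γ(j+μ+1)/(Γ(μ+1)Γ(j+1)))(1/c₁)∫₁^∞ s^{-(1+a+1/c₁+λ)}(1−s^{-1})^i(1−s^{-a})^j s^{-aμ} ds, and let p(i,j) = (γ/(α+γ)) q₁(i−1,j) + (α/(α+γ)) q₂(i,j−1) (terms with a negative argument vanish). Then for all x, y > 0, lim_{n→∞} p(⌊n^{c₁} x⌋, ⌊n^{c₂} y⌋)/n^{-(1+c₁+c₂)} = (γ/(α+γ)) (x^λ y^{μ-1}/(c₁ Γ(λ+1) Γ(μ))) ∫₀^∞ z^{-(2+1/c₁+λ+aμ)} e^{-(x/z + y/z^a)} dz + (α/(α+γ)) (x^{λ-1} y^μ/(c₁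 Γ(λ) Γ(μ+1))) ∫₀^∞ z^{-(1+a+1/c₁+λ+aμ)} e^{-(x/z + y/z^a)} dz. -/

import Mathlib

open Real Filter Topology

theorem Real.Gamma_add_natCast_add_one (s : ℝ) (hs : 0 < s) (n : ℕ) :
    Gamma (s + n + 1) = Gamma s * ∏ j ∈ Finset.range (n + 1), (s + j) := by
  induction n with
  | zero => simp [Gamma_add_one hs.ne', mul_comm]
  | succ n ih =>
    have h : s + ((n + 1 : ℕ) : ℝ) ≠ 0 := by positivity
    rw [Gamma_add_one h, Finset.prod_range_succ, ← mul_assoc, ← ih]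
    push_cast
    rw [← add_assoc, mul_comm]

/-- The ratio `Γ(n + s) / Γ(n + 1)` is asymptotic to `n ^ (s - 1)`. -/
theorem Real.tendsto_Gamma_ratio_mul_rpow (s : ℝ) (hs : 0 < s) :
    Tendsto (fun n : ℕ => Gamma (n + s) / Gamma ((n : ℝ) + 1) * (n : ℝ) ^ (1 - s))
      atTop (𝓝 1) := by
  have h₁ : Tendsto (fun n : ℕ => Gamma s / GammaSeq s n) atTop (𝓝 1) := by
    have hG := (Gamma_pos_of_pos hs).ne'
    have h := (tendsto_const_nhds (x := Gamma s)).div (GammaSeq_tendsto_Gamma s) hG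
    rw [div_self hG] at h
    exact h
  have h₂ : Tendsto (fun n : ℕ => (n : ℝ) / (n + s)) atTop (𝓝 1) :=
    tendsto_natCast_div_add_atTop s
  have h₃ := h₁.mul h₂
  rw [mul_one] at h₃
  refine h₃.congr' ?_
  filter_upwards [eventually_gt_atTop 0] with n hn
  have hn' : (0 : ℝ) < n := by exact_mod_cast hn
  have hprod : 0 < ∏ j ∈ Finset.range (n + 1), (s + j) :=
    Finset.prod_pos fun j _ => by positivity
  have hrec : Gamma s * ∏ j ∈ Finset.range (n + 1), (s + j) = (n + s) * Gamma (n + s) := by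
    rw [← Gamma_add_natCast_add_one s hs, Gamma_add_one (by positivity), add_comm s]
  have hfac := Nat.factorial_pos n
  have hpow : 0 < (n : ℝ) ^ s := by positivity
  rw [GammaSeq, Gamma_nat_eq_factorial, rpow_sub hn', rpow_one, div_div_eq_mul_div, hrec]
  field_simp

theorem tendsto_Gamma_ratio_mul_rpow_of_tendsto_div {ι : Type*} {l : Filter ι}
    {m : ι → ℕ} {N : ι → ℝ} {x s : ℝ} (hs : 0 < s) (hx : 0 < x) (hN : Tendsto N l atTop)
    (hm : Tendsto (fun i => (m i : ℝ) / N i) l (𝓝 x)) :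
    Tendsto (fun i => Gamma (m i + s) / Gamma ((m i : ℝ) + 1) * N i ^ (1 - s)) l
      (𝓝 (x ^ (s - 1))) := by
  have hm' : Tendsto (fun i => (m i : ℝ)) l atTop := by
    refine (hm.pos_mul_atTop hx hN).congr' ?_
    filter_upwards [hN.eventually_gt_atTop 0] with i hi
    field_simp
  have h₁ := (tendsto_Gamma_ratio_mul_rpow s hs).comp (tendsto_natCast_atTop_iff.mp hm')
  have h₂ := hm.rpow_const (p := s - 1) (Or.inl hx.ne')
  have h₃ := h₁.mul h₂
  rw [one_mul] at h₃
  refine h₃.congr' ?_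
  filter_upwards [hN.eventually_gt_atTop 0, hm'.eventually_gt_atTop 0] with i hi hi'
  have e : (s - 1) = -(1 - s) := by ring
  simp only [Function.comp_apply]
  rw [div_rpow hi'.le hi.le, e, rpow_neg hi'.le, rpow_neg hi.le]
  have := rpow_pos_of_pos hi (1 - s)
  have := rpow_pos_of_pos hi' (1 - s)
  field_simp

theorem tendsto_one_sub_pow_exp_neg {ι : Type*} {l : Filter ι} {m : ι → ℕ} {t : ι → ℝ} {b : ℝ}
    (ht : Tendsto t l (𝓝 0)) (hmt : Tendsto (fun i => m i * t i) l (𝓝 b)) :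
    Tendsto (fun i => (1 - t i) ^ m i) l (𝓝 (exp (-b))) := by
  have hlt : ∀ᶠ i in l, t i < 1 := ht.eventually_lt_const one_pos
  have hlow : Tendsto (fun i => exp (-(m i * t i / (1 - t i)))) l (𝓝 (exp (-b))) := by
    have h := hmt.div (tendsto_const_nhds.sub ht) (by norm_num : (1 : ℝ) - 0 ≠ 0)
    rw [sub_zero, div_one] at h
    exact (continuous_exp.tendsto _).comp h.neg
  have hup : Tendsto (fun i => exp (-(m i * t i))) l (𝓝 (exp (-b))) :=
    (continuous_exp.tendsto _).comp hmt.neg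
  refine tendsto_of_tendsto_of_tendsto_of_le_of_le' hlow hup ?_ ?_
  · filter_upwards [hlt] with i hi
    have h0 : 0 < 1 - t i := by linarith
    have h1 : exp (-(t i / (1 - t i))) ≤ 1 - t i := by
      rw [← le_log_iff_exp_le h0]
      convert one_sub_inv_le_log_of_pos h0 using 1
      field_simp
      ring
    calc exp (-(m i * t i / (1 - t i))) = exp (-(t i / (1 - t i))) ^ m i := by
          rw [← exp_nat_mul]; ring_nf
      _ ≤ _ := by gcongr
  · filter_upwards [hlt] with i hi
    have h1 : 1 - t i ≤ exp (-t i) := by linarith [add_one_le_exp (-t i)]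
    calc (1 - t i) ^ m i ≤ exp (-t i) ^ m i := by
          gcongr
      _ = _ := by rw [← exp_nat_mul]; ring_nf

theorem integrableOn_rpow_neg_mul_exp_neg_div {k b : ℝ} (hk : 1 < k) (hb : 0 < b) :
    MeasureTheory.IntegrableOn (fun z : ℝ => z ^ (-k) * exp (-(b / z))) (Set.Ioi 0) := by
  have h := integrableOn_rpow_mul_exp_neg_mul_rpow (p := 1) (s := k - 2) (b := b)
    (by linarith) one_pos hb
  rw [← MeasureTheory.integrableOn_Ioi_comp_rpow_iff _ (p := -1) (by norm_num)] at h
  refine h.congr_fun (fun z hz => ?_) measurableSet_Ioi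
  have hz : 0 < z := hz
  simp only [smul_eq_mul, abs_neg, abs_one, one_mul, rpow_one]
  rw [← rpow_mul hz.le, ← mul_assoc, ← rpow_add hz, rpow_neg_one]
  ring_nf

/-- Scaling limit of the mixture integrals: dominated convergence after the substitution
`s = N z`. -/
theorem tendsto_rpow_mul_integral_one_sub_pow {ι : Type*} {l : Filter ι} [l.IsCountablyGenerated]
    {m k : ι → ℕ} {N : ι → ℝ} {x y a κ : ℝ} (hx : 0 < x) (ha : 0 < a) (hκ : 1 < κ)
    (hN : Tendsto N l atTop) (hm : Tendsto (fun i => (m i : ℝ) / N i) l (𝓝 x))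
    (hk : Tendsto (fun i => (k i : ℝ) / N i ^ a) l (𝓝 y)) :
    Tendsto
      (fun i => N i ^ (κ - 1) *
        ∫ s in Set.Ioi (1 : ℝ), s ^ (-κ) * (1 - s⁻¹) ^ m i * (1 - s ^ (-a)) ^ k i) l
      (𝓝 (∫ z in Set.Ioi (0 : ℝ), z ^ (-κ) * exp (-(x / z + y / z ^ a)))) := by
  let F : ι → ℝ → ℝ := fun i => (Set.Ioi (N i)⁻¹).indicator fun z =>
    z ^ (-κ) * (1 - (N i * z)⁻¹) ^ m i * (1 - (N i * z) ^ (-a)) ^ k i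
  have hF : ∀ᶠ i in l, ∫ z in Set.Ioi (0 : ℝ), F i z = N i ^ (κ - 1) *
      ∫ s in Set.Ioi (1 : ℝ), s ^ (-κ) * (1 - s⁻¹) ^ m i * (1 - s ^ (-a)) ^ k i := by
    filter_upwards [hN.eventually_gt_atTop 0] with i hi
    have h := MeasureTheory.integral_comp_mul_left_Ioi'
      (fun s => s ^ (-κ) * (1 - s⁻¹) ^ m i * (1 - s ^ (-a)) ^ k i) (N i)⁻¹ hi
    rw [mul_inv_cancel₀ hi.ne'] at h
    have hsub : Set.Ioi (0 : ℝ) ∩ Set.Ioi (N i)⁻¹ = Set.Ioi (N i)⁻¹ :=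
      Set.inter_eq_right.mpr (Set.Ioi_subset_Ioi (by positivity))
    rw [← h, smul_eq_mul, ← mul_assoc, ← MeasureTheory.integral_const_mul,
      MeasureTheory.setIntegral_indicator measurableSet_Ioi, hsub]
    refine MeasureTheory.setIntegral_congr_fun measurableSet_Ioi fun z hz => ?_
    have hz : 0 < z := lt_trans (inv_pos.mpr hi) hz
    have e : N i ^ (κ - 1) * N i * N i ^ (-κ) = 1 := by
      nth_rewrite 2 [← rpow_one (N i)]
      rw [← rpow_add hi, ← rpow_add hi]
      simp
    rw [mul_rpow hi.le hz.le (z := -κ)]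
    linear_combination (-(z ^ (-κ) * (1 - (N i * z)⁻¹) ^ m i * (1 - (N i * z) ^ (-a)) ^ k i)) * e
  refine Tendsto.congr' hF ?_
  refine MeasureTheory.tendsto_integral_filter_of_dominated_convergence
    (fun z => z ^ (-κ) * exp (-(x / 2 / z))) ?_ ?_
    (integrableOn_rpow_neg_mul_exp_neg_div hκ (half_pos hx)) ?_
  · refine Eventually.of_forall fun i => Measurable.aestronglyMeasurable ?_
    refine Measurable.indicator ?_ measurableSet_Ioi
    fun_prop
  · filter_upwards [hN.eventually_gt_atTop 0, hm.eventually_const_lt (half_lt_self hx)]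
      with i hi hmi
    refine (MeasureTheory.ae_restrict_iff' measurableSet_Ioi).mpr (Eventually.of_forall ?_)
    intro z hz
    have hz : 0 < z := hz
    by_cases hzN : z ∈ Set.Ioi (N i)⁻¹
    · have h1 : 1 < N i * z := by
        have := (inv_lt_iff_one_lt_mul₀ hi).mp hzN
        linarith
      have h0 : 0 < N i * z := by linarith
      have hinv : (N i * z)⁻¹ ≤ 1 := inv_le_one_of_one_le₀ h1.le
      have hb : 0 ≤ 1 - (N i * z) ^ (-a) ∧ 1 - (N i * z) ^ (-a) ≤ 1 := by
        have := rpow_le_one_of_one_le_of_nonpos h1.le (neg_nonpos.mpr ha.le)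
        have := rpow_pos_of_pos h0 (-a)
        constructor <;> linarith
      have hc : (1 - (N i * z)⁻¹) ^ m i ≤ exp (-(x / 2 / z)) := by
        have hle : 1 - (N i * z)⁻¹ ≤ exp (-(N i * z)⁻¹) := by
          linarith [add_one_le_exp (-(N i * z)⁻¹)]
        calc (1 - (N i * z)⁻¹) ^ m i ≤ exp (-(N i * z)⁻¹) ^ m i :=
              pow_le_pow_left₀ (by linarith) hle _
          _ = exp (-(m i / N i / z)) := by
              rw [← exp_nat_mul]
              congr 1
              field_simp
          _ ≤ exp (-(x / 2 / z)) := by gcongr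
      simp only [F, Set.indicator_of_mem hzN]
      have hp : 0 ≤ (1 - (N i * z)⁻¹) ^ m i := pow_nonneg (by linarith) _
      have hq := pow_nonneg hb.1 (k i)
      rw [norm_of_nonneg (by positivity)]
      calc _ ≤ z ^ (-κ) * (1 - (N i * z)⁻¹) ^ m i * 1 := by
            gcongr
            exact pow_le_one₀ hb.1 hb.2
        _ ≤ _ := by rw [mul_one]; gcongr
    · simp only [F, Set.indicator_of_notMem hzN, norm_zero]
      positivity
  · refine (MeasureTheory.ae_restrict_iff' measurableSet_Ioi).mpr (Eventually.of_forall ?_)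
    intro z hz
    have hz : 0 < z := hz
    have hNz : Tendsto (fun i => N i * z) l atTop := hN.atTop_mul_const hz
    have h₁ := tendsto_one_sub_pow_exp_neg (m := m) (b := x / z)
      (tendsto_inv_atTop_zero.comp hNz) (by
        refine (hm.div_const z).congr fun i => ?_
        simp only [Function.comp_apply, div_eq_mul_inv, mul_inv, mul_assoc])
    have h₂ := tendsto_one_sub_pow_exp_neg (m := k) (b := y / z ^ a)
      ((tendsto_rpow_neg_atTop ha).comp hNz) (by
        refine (hk.div_const (z ^ a)).congr' ?_
        filter_upwards [hN.eventually_gt_atTop 0] with i hi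
        simp only [Function.comp_apply]
        rw [rpow_neg (by positivity), mul_rpow hi.le hz.le, div_div, div_eq_mul_inv])
    have h₃ := (h₁.const_mul (z ^ (-κ))).mul h₂
    rw [mul_assoc, ← exp_add, ← neg_add] at h₃
    refine h₃.congr' ?_
    filter_upwards [hN.eventually_gt_atTop z⁻¹] with i hi
    have hmem : z ∈ Set.Ioi (N i)⁻¹ := inv_lt_of_inv_lt₀ hz hi
    simp only [F, Set.indicator_of_mem hmem, Function.comp_apply]

theorem tendsto_mixture_mass_mul_rpow {ι : Type*} {l : Filter ι} [l.IsCountablyGenerated]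
    {m k : ι → ℕ} {N : ι → ℝ} {x y a s t κ ν : ℝ} (c : ℝ) (hx : 0 < x) (hy : 0 < y) (ha : 0 < a)
    (hs : 0 < s) (ht : 0 < t) (hκ : 1 < κ + ν) (hN : Tendsto N l atTop)
    (hm : Tendsto (fun i => (m i : ℝ) / N i) l (𝓝 x))
    (hk : Tendsto (fun i => (k i : ℝ) / N i ^ a) l (𝓝 y)) :
    Tendsto
      (fun i => (Gamma (m i + s) / (Gamma s * Gamma ((m i : ℝ) + 1)) *
          (Gamma (k i + t) / (Gamma t * Gamma ((k i : ℝ) + 1))) * (1 / c) *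
          ∫ u in Set.Ioi (1 : ℝ),
            u ^ (-κ) * (1 - u⁻¹) ^ m i * (1 - u ^ (-a)) ^ k i * u ^ (-ν)) *
        (N i ^ (1 - s) * (N i ^ a) ^ (1 - t) * N i ^ (κ + ν - 1))) l
      (𝓝 (x ^ (s - 1) * y ^ (t - 1) / (c * Gamma s * Gamma t) *
        ∫ z in Set.Ioi (0 : ℝ), z ^ (-(κ + ν)) * exp (-(x / z + y / z ^ a)))) := by
  have h₁ := tendsto_Gamma_ratio_mul_rpow_of_tendsto_div hs hx hN hm
  have h₂ := tendsto_Gamma_ratio_mul_rpow_of_tendsto_div ht hy ((tendsto_rpow_atTop ha).comp hN) hk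
  have h₃ := tendsto_rpow_mul_integral_one_sub_pow hx ha hκ hN hm hk
  have h := ((h₁.mul h₂).div_const (c * Gamma s * Gamma t)).mul h₃
  refine h.congr fun i => ?_
  have e : ∫ u in Set.Ioi (1 : ℝ),
        u ^ (-κ) * (1 - u⁻¹) ^ m i * (1 - u ^ (-a)) ^ k i * u ^ (-ν) =
      ∫ u in Set.Ioi (1 : ℝ), u ^ (-(κ + ν)) * (1 - u⁻¹) ^ m i * (1 - u ^ (-a)) ^ k i := by
    refine MeasureTheory.setIntegral_congr_fun measurableSet_Ioi fun u hu => ?_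
    have hu : 0 < u := one_pos.trans hu
    rw [neg_add, rpow_add hu]
    ring
  rw [e]
  simp only [Function.comp_apply]
  ring

theorem tendsto_floor_mul_div {ι : Type*} {l : Filter ι} {N : ι → ℝ} {x : ℝ} (hx : 0 ≤ x)
    (hN : Tendsto N l atTop) : Tendsto (fun i => (⌊N i * x⌋₊ : ℝ) / N i) l (𝓝 x) := by
  simpa only [Function.comp_def, mul_comm x] using (tendsto_nat_floor_mul_div_atTop hx).comp hN

theorem tendsto_floor_mul_sub_one_div {ι : Type*} {l : Filter ι} {N : ι → ℝ} {x : ℝ} (hx : 0 < x)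
    (hN : Tendsto N l atTop) :
    Tendsto (fun i => ((⌊N i * x⌋₊ - 1 : ℕ) : ℝ) / N i) l (𝓝 x) := by
  have h := (tendsto_floor_mul_div hx.le hN).sub (tendsto_inv_atTop_zero.comp hN)
  rw [sub_zero] at h
  refine h.congr' ?_
  filter_upwards [(tendsto_nat_floor_atTop.comp (hN.atTop_mul_const hx)).eventually_ge_atTop 1]
    with i hi
  simp only [Function.comp_apply] at hi ⊢
  rw [Nat.cast_sub hi, Nat.cast_one, sub_div, one_div]

/-- regular variation of the asymptotic joint in/out-degree pmf
`p(i,j)` in the non-standard case `c₁ ≠ c₂` of the preferential attachment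
model: `p(⌊n^{c₁}x⌋,⌊n^{c₂}y⌋)/n^{-(1+c₁+c₂)}` converges to the stated
mixture limit. -/
theorem stmt_17
    (lam mu c₁ c₂ : ℝ) (hlam : 0 < lam) (hmu : 0 < mu)
    (hc₁ : c₁ ∈ Set.Ioo (0 : ℝ) 1) (hc₂ : c₂ ∈ Set.Ioo (0 : ℝ) 1)
    (hc : c₁ ≠ c₂) (a : ℝ) (ha : a = c₂ / c₁)
    (α γ : ℝ) (hα : 0 ≤ α) (hγ : 0 ≤ γ) (hαγ : 0 < α + γ)
    (q₁ q₂ : ℕ → ℕ → ℝ)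
    (hq₁ : ∀ i j : ℕ, q₁ i j =
      (Gamma ((i : ℝ) + lam + 1) / (Gamma (lam + 1) * Gamma ((i : ℝ) + 1))) *
        (Gamma ((j : ℝ) + mu) / (Gamma mu * Gamma ((j : ℝ) + 1))) *
        (1 / c₁) *
        ∫ s in Set.Ioi (1 : ℝ),
          s ^ (-(2 + 1 / c₁ + lam)) * (1 - s⁻¹) ^ i * (1 - s ^ (-a)) ^ j *
            s ^ (-(a * mu)))
    (hq₂ : ∀ i j : ℕ, q₂ i j =
      (Gamma ((i : ℝ) + lam) / (Gamma lam * Gamma ((i : ℝ) + 1))) *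
        (Gamma ((j : ℝ) + mu + 1) / (Gamma (mu + 1) * Gamma ((j : ℝ) + 1))) *
        (1 / c₁) *
        ∫ s in Set.Ioi (1 : ℝ),
          s ^ (-(1 + a + 1 / c₁ + lam)) * (1 - s⁻¹) ^ i * (1 - s ^ (-a)) ^ j *
            s ^ (-(a * mu)))
    (p : ℕ → ℕ → ℝ)
    (hp : ∀ i j : ℕ, p i j =
      (if i = 0 then 0 else γ / (α + γ) * q₁ (i - 1) j) +
      (if j = 0 then 0 else α / (α + γ) * q₂ i (j - 1))) :
    ∀ x y : ℝ, 0 < x → 0 < y →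
      Tendsto
        (fun n : ℕ => p ⌊(n : ℝ) ^ c₁ * x⌋₊ ⌊(n : ℝ) ^ c₂ * y⌋₊ /
          (n : ℝ) ^ (-(1 + c₁ + c₂)))
        atTop
        (𝓝 (γ / (α + γ) *
              (x ^ lam * y ^ (mu - 1) / (c₁ * Gamma (lam + 1) * Gamma mu)) *
              (∫ z in Set.Ioi (0 : ℝ),
                z ^ (-(2 + 1 / c₁ + lam + a * mu)) *
                  exp (-(x / z + y / z ^ a))) +
            α / (α + γ) *
              (x ^ (lam - 1) * y ^ mu / (c₁ * Gamma lam * Gamma (mu + 1))) *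
              (∫ z in Set.Ioi (0 : ℝ),
                z ^ (-(1 + a + 1 / c₁ + lam + a * mu)) *
                  exp (-(x / z + y / z ^ a))))) := by
  intro x y hx hy
  obtain ⟨hc₁, -⟩ := hc₁
  obtain ⟨hc₂, -⟩ := hc₂
  have ha₀ : 0 < a := ha ▸ div_pos hc₂ hc₁
  have hca : c₁ * a = c₂ := by rw [ha]; field_simp
  have hN₁ : Tendsto (fun n : ℕ => (n : ℝ) ^ c₁) atTop atTop :=
    (tendsto_rpow_atTop hc₁).comp tendsto_natCast_atTop_atTop
  have hN₂ : Tendsto (fun n : ℕ => (n : ℝ) ^ c₂) atTop atTop :=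
    (tendsto_rpow_atTop hc₂).comp tendsto_natCast_atTop_atTop
  have hpow (n : ℕ) : ((n : ℝ) ^ c₁) ^ a = (n : ℝ) ^ c₂ := by
    rw [← rpow_mul n.cast_nonneg, hca]
  have hinv : 0 < 1 / c₁ := by positivity
  have haμ : 0 < a * mu := by positivity
  have h₁ := (tendsto_mixture_mass_mul_rpow (s := lam + 1) (t := mu) (a := a)
    (κ := 2 + 1 / c₁ + lam) (ν := a * mu) c₁ hx hy ha₀ (by linarith) hmu (by linarith) hN₁
    (tendsto_floor_mul_sub_one_div hx hN₁)
    (by simpa only [hpow] using tendsto_floor_mul_div hy.le hN₂)).const_mul (γ / (α + γ))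
  have h₂ := (tendsto_mixture_mass_mul_rpow (s := lam) (t := mu + 1) (a := a)
    (κ := 1 + a + 1 / c₁ + lam) (ν := a * mu) c₁ hx hy ha₀ hlam (by linarith) (by linarith) hN₁
    (tendsto_floor_mul_div hx.le hN₁)
    (by simpa only [hpow] using tendsto_floor_mul_sub_one_div hy hN₂)).const_mul (α / (α + γ))
  have h := h₁.add h₂
  simp only [add_sub_cancel_right] at h
  rw [mul_assoc (γ / (α + γ)), mul_assoc (α / (α + γ))]
  refine h.congr' ?_
  filter_upwards [eventually_gt_atTop 0,
    (tendsto_nat_floor_atTop.comp (hN₁.atTop_mul_const hx)).eventually_ge_atTop 1,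
    (tendsto_nat_floor_atTop.comp (hN₂.atTop_mul_const hy)).eventually_ge_atTop 1]
    with n hn hi hj
  simp only [Function.comp_apply] at hi hj
  have hn' : (0 : ℝ) < n := by exact_mod_cast hn
  have e₁ : ((n : ℝ) ^ c₁) ^ (1 - (lam + 1)) * (((n : ℝ) ^ c₁) ^ a) ^ (1 - mu) *
      ((n : ℝ) ^ c₁) ^ (2 + 1 / c₁ + lam + a * mu - 1) = (n : ℝ) ^ (1 + c₁ + c₂) := by
    simp only [← rpow_mul hn'.le, ← rpow_add hn']
    rw [← hca]
    congr 1
    field_simp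
    ring
  have e₂ : ((n : ℝ) ^ c₁) ^ (1 - lam) * (((n : ℝ) ^ c₁) ^ a) ^ (1 - (mu + 1)) *
      ((n : ℝ) ^ c₁) ^ (1 + a + 1 / c₁ + lam + a * mu - 1) = (n : ℝ) ^ (1 + c₁ + c₂) := by
    simp only [← rpow_mul hn'.le, ← rpow_add hn']
    rw [← hca]
    congr 1
    field_simp
    ring
  rw [hp, if_neg (by lia), if_neg (by lia), hq₁, hq₂, rpow_neg hn'.le, div_inv_eq_mul]
  rw [e₁, e₂]
  simp only [add_assoc]
  ring
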